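/- Let G = [Sp(2g, ℤ)]_{e₁} be the stabilizer of e₁ in Sp(2g, ℤ), and let G[ℓ] = {A ∈ G : A ≡ I mod ℓ}. Then for positive integers ℓ and m: G[ℓ] ∩ G[m] = G[lcm(ℓ, m)] and G[ℓ] · G[m] = G[gcd(ℓ, m)]. -/

import Mathlib

open Matrix

/-- The first standard basis vector `e₁` of `ℤ^{2g}` (indexed by `Fin g ⊕ Fin g`). -/
def stdE1 (g : ℕ) : (Fin g ⊕ Fin g) → ℤ :=
  fun k => match k with
  | Sum.inl i => if (i : ℕ) = 0 then 1 else 0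
  | Sum.inr _ => 0

/-- The stabilizer `[Sp(2g, ℤ)]_{e₁}` of `e₁` in the integral symplectic group. -/
def spStabE1 (g : ℕ) : Subgroup (Matrix.symplecticGroup (Fin g) ℤ) where
  carrier := {A | (A : Matrix (Fin g ⊕ Fin g) (Fin g ⊕ Fin g) ℤ).mulVec (stdE1 g) = stdE1 g}
  one_mem' := by
    show ((1 : Matrix.symplecticGroup (Fin g) ℤ) :
        Matrix (Fin g ⊕ Fin g) (Fin g ⊕ Fin g) ℤ).mulVec (stdE1 g) = stdE1 g
    rw [Submonoid.coe_one, Matrix.one_mulVec]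
  mul_mem' := by
    intro a b ha hb
    show ((a * b : Matrix.symplecticGroup (Fin g) ℤ) :
        Matrix (Fin g ⊕ Fin g) (Fin g ⊕ Fin g) ℤ).mulVec (stdE1 g) = stdE1 g
    rw [Submonoid.coe_mul, ← Matrix.mulVec_mulVec, hb, ha]
  inv_mem' := by
    intro a ha
    show ((a⁻¹ : Matrix.symplecticGroup (Fin g) ℤ) :
        Matrix (Fin g ⊕ Fin g) (Fin g ⊕ Fin g) ℤ).mulVec (stdE1 g) = stdE1 g
    conv_lhs => rw [← ha]
    rw [Matrix.mulVec_mulVec, ← Submonoid.coe_mul]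
    rw [inv_mul_cancel a, Submonoid.coe_one, Matrix.one_mulVec]

/-- Reduction of an element of the stabilizer of `e₁` modulo `ℓ`, as a map to units of the
matrix ring over `ZMod ℓ`. -/
noncomputable def spStabMod (g ℓ : ℕ) :
    spStabE1 g →* (Matrix (Fin g ⊕ Fin g) (Fin g ⊕ Fin g) (ZMod ℓ))ˣ :=
  MonoidHom.toHomUnits
    (((Int.castRingHom (ZMod ℓ)).mapMatrix.toMonoidHom).comp
      (((Matrix.symplecticGroup (Fin g) ℤ).subtype).comp (spStabE1 g).subtype))

/-- The level-`ℓ` congruence subgroup `G[ℓ]` of `G = [Sp(2g, ℤ)]_{e₁}`: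
elements congruent to the identity mod `ℓ`. -/
noncomputable def spStabCong (g ℓ : ℕ) : Subgroup (spStabE1 g) :=
  (spStabMod g ℓ).ker


/-! ### The symplectic form and transvections -/

section Helpers

variable {n : ℕ} {R : Type*} [CommRing R]

/-- the symplectic form -/
def omg (x y : (Fin n ⊕ Fin n) → R) : R := x ⬝ᵥ (Matrix.J (Fin n) R *ᵥ y)

lemma omg_eq (x y : (Fin n ⊕ Fin n) → R) :
    omg x y = ∑ i, (x (Sum.inr i) * y (Sum.inl i) - x (Sum.inl i) * y (Sum.inr i)) := by
  have hJ : Matrix.J (Fin n) R *ᵥ y =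
      Sum.elim (fun i => - y (Sum.inr i)) (fun i => y (Sum.inl i)) := by
    rw [Matrix.J, Matrix.fromBlocks_mulVec]
    congr 1
    · funext i; simp [Matrix.neg_mulVec]
    · funext i; simp
  rw [omg, hJ, dotProduct, Fintype.sum_sum_type, ← Finset.sum_add_distrib]
  refine Finset.sum_congr rfl fun i _ => ?_
  simp only [Sum.elim_inl, Sum.elim_inr]
  ring

lemma omg_add_left (x y z : (Fin n ⊕ Fin n) → R) : omg (x + y) z = omg x z + omg y z := by
  simp [omg, add_dotProduct]

lemma omg_add_right (x y z : (Fin n ⊕ Fin n) → R) : omg x (y + z) = omg x y + omg x z := by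
  simp [omg, Matrix.mulVec_add, dotProduct_add]

lemma omg_smul_left (a : R) (x z : (Fin n ⊕ Fin n) → R) : omg (a • x) z = a * omg x z := by
  simp [omg]

lemma omg_smul_right (a : R) (x z : (Fin n ⊕ Fin n) → R) : omg x (a • z) = a * omg x z := by
  simp [omg, Matrix.mulVec_smul]

lemma omg_sub_left (x y z : (Fin n ⊕ Fin n) → R) : omg (x - y) z = omg x z - omg y z := by
  simp [omg, sub_dotProduct]

lemma omg_sub_right (x y z : (Fin n ⊕ Fin n) → R) : omg x (y - z) = omg x y - omg x z := by
  simp [omg, Matrix.mulVec_sub, dotProduct_sub]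

lemma omg_self (x : (Fin n ⊕ Fin n) → R) : omg x x = 0 := by
  rw [omg_eq]; exact Finset.sum_eq_zero fun i _ => by ring

lemma omg_symm (x y : (Fin n ⊕ Fin n) → R) : omg x y = - omg y x := by
  rw [omg_eq, omg_eq, ← Finset.sum_neg_distrib]
  exact Finset.sum_congr rfl fun i _ => by ring

/-- the basis vectors -/
def be (i : Fin n) : (Fin n ⊕ Fin n) → R := Pi.single (Sum.inl i) 1
def bf (i : Fin n) : (Fin n ⊕ Fin n) → R := Pi.single (Sum.inr i) 1

lemma omg_be (x : (Fin n ⊕ Fin n) → R) (i : Fin n) : omg x (be i) = x (Sum.inr i) := by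
  rw [omg_eq, Finset.sum_eq_single i]
  · simp [be]
  · intro j _ hj; simp [be, hj]
  · simp

lemma omg_bf (x : (Fin n ⊕ Fin n) → R) (i : Fin n) : omg x (bf i) = - x (Sum.inl i) := by
  rw [omg_eq, Finset.sum_eq_single i]
  · simp [bf]
  · intro j _ hj; simp [bf, hj]
  · simp

lemma omg_mem {A : Matrix (Fin n ⊕ Fin n) (Fin n ⊕ Fin n) R} :
    A ∈ Matrix.symplecticGroup (Fin n) R ↔ ∀ x y, omg (A *ᵥ x) (A *ᵥ y) = omg x y := by
  rw [SymplecticGroup.mem_iff']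
  have key : ∀ x y, omg (A *ᵥ x) (A *ᵥ y) = x ⬝ᵥ ((Aᵀ * Matrix.J (Fin n) R * A) *ᵥ y) := by
    intro x y
    rw [omg, ← Matrix.mulVec_mulVec, ← Matrix.mulVec_mulVec, Matrix.dotProduct_mulVec x,
      Matrix.vecMul_transpose]
  constructor
  · intro h x y
    rw [key, h, omg]
  · intro h
    ext i j
    have := h (Pi.single i 1) (Pi.single j 1)
    rw [key] at this
    simpa [omg] using this

/-- transvections -/
def trv (v : (Fin n ⊕ Fin n) → R) (a : R) : Matrix (Fin n ⊕ Fin n) (Fin n ⊕ Fin n) R :=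
  1 + a • Matrix.vecMulVec v (Matrix.J (Fin n) R *ᵥ v)

lemma trv_apply (v : (Fin n ⊕ Fin n) → R) (a : R) (x) :
    trv v a *ᵥ x = x + (a * omg x v) • v := by
  rw [trv, Matrix.add_mulVec, Matrix.one_mulVec, Matrix.smul_mulVec, Matrix.vecMulVec_mulVec,
    omg, dotProduct_comm x]
  ext i
  simp [mul_comm, mul_left_comm]

lemma trv_mem (v : (Fin n ⊕ Fin n) → R) (a : R) : trv v a ∈ Matrix.symplecticGroup (Fin n) R := by
  rw [omg_mem]
  intro x y
  simp only [trv_apply, omg_add_left, omg_add_right, omg_smul_left, omg_smul_right, omg_self]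
  rw [omg_symm v y]
  ring

lemma trv_inv (v : (Fin n ⊕ Fin n) → R) (a : R) : trv v (-a) * trv v a = 1 := by
  apply Matrix.ext_of_mulVec_single
  intro i
  rw [← Matrix.mulVec_mulVec]
  simp only [trv_apply, omg_add_left, omg_smul_left, omg_self, Matrix.one_mulVec]
  ext j
  simp

lemma trv_fix {v : (Fin n ⊕ Fin n) → R} {a : R} {x} (h : omg x v = 0) : trv v a *ᵥ x = x := by
  simp [trv_apply, h]

/-- vanishing of the coordinates in `s` -/
def vanishOn (s : Finset (Fin n)) (v : (Fin n ⊕ Fin n) → R) : Prop :=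
  ∀ i ∈ s, v (Sum.inl i) = 0 ∧ v (Sum.inr i) = 0

/-- fixing the basis vectors in `s` -/
def fixOn (s : Finset (Fin n)) (A : Matrix (Fin n ⊕ Fin n) (Fin n ⊕ Fin n) R) : Prop :=
  ∀ i ∈ s, A *ᵥ be i = be i ∧ A *ᵥ bf i = bf i

lemma fixOn_mul {s : Finset (Fin n)} {A : Matrix (Fin n ⊕ Fin n) (Fin n ⊕ Fin n) R}
    (hA : fixOn s A) {v : (Fin n ⊕ Fin n) → R} (hv : vanishOn s v) (a : R) :
    fixOn s (trv v a * A) := by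
  intro i hi
  obtain ⟨h1, h2⟩ := hA i hi
  obtain ⟨h3, h4⟩ := hv i hi
  rw [← Matrix.mulVec_mulVec, ← Matrix.mulVec_mulVec, h1, h2]
  constructor
  · apply trv_fix; rw [omg_symm, omg_be, h4, neg_zero]
  · apply trv_fix; rw [omg_symm, omg_bf, h3, neg_zero, neg_zero]

lemma vanishOn_image {s : Finset (Fin n)} {A : Matrix (Fin n ⊕ Fin n) (Fin n ⊕ Fin n) R}
    (hA : A ∈ Matrix.symplecticGroup (Fin n) R) (hs : fixOn s A) {v : (Fin n ⊕ Fin n) → R}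
    (hv : vanishOn s v) : vanishOn s (A *ᵥ v) := by
  rw [omg_mem] at hA
  intro i hi
  obtain ⟨h1, h2⟩ := hs i hi
  obtain ⟨h3, h4⟩ := hv i hi
  constructor
  · have := hA v (bf i)
    rw [h2, omg_bf, omg_bf, h3] at this
    simpa using this
  · have := hA v (be i)
    rw [h1, omg_be, omg_be, h4] at this
    simpa using this

lemma vanishOn.add {s : Finset (Fin n)} {v w : (Fin n ⊕ Fin n) → R} (hv : vanishOn s v)
    (hw : vanishOn s w) : vanishOn s (v + w) := by
  intro i hi; simp [hv i hi, hw i hi]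

lemma vanishOn.sub {s : Finset (Fin n)} {v w : (Fin n ⊕ Fin n) → R} (hv : vanishOn s v)
    (hw : vanishOn s w) : vanishOn s (v - w) := by
  intro i hi; simp [hv i hi, hw i hi]

lemma vanishOn.smul {s : Finset (Fin n)} {v : (Fin n ⊕ Fin n) → R} (hv : vanishOn s v)
    (a : R) : vanishOn s (a • v) := by
  intro i hi; simp [hv i hi]

lemma vanishOn_be {s : Finset (Fin n)} {k : Fin n} (hk : k ∉ s) :
    vanishOn s (be k : (Fin n ⊕ Fin n) → R) := by
  intro i hi
  have : i ≠ k := fun h => hk (h ▸ hi)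
  simp [be, this]

lemma vanishOn_bf {s : Finset (Fin n)} {k : Fin n} (hk : k ∉ s) :
    vanishOn s (bf k : (Fin n ⊕ Fin n) → R) := by
  intro i hi
  have : i ≠ k := fun h => hk (h ▸ hi)
  simp [bf, this]

/-- Moving `A f_k` to `f_k` by transvections that fix `e_k`. -/
lemma even_step {s : Finset (Fin n)} {k : Fin n} (hk : k ∉ s)
    (P : Matrix (Fin n ⊕ Fin n) (Fin n ⊕ Fin n) R → Prop)
    (hP : ∀ v a A, vanishOn s v → v (Sum.inr k) = 0 → P (trv v a * A) → P A)
    (ih : ∀ A ∈ Matrix.symplecticGroup (Fin n) R, fixOn (insert k s) A → P A)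
    (A) (hA : A ∈ Matrix.symplecticGroup (Fin n) R) (hs : fixOn s A)
    (he : A *ᵥ be k = be k) : P A := by
  set u := A *ᵥ bf k with hu
  have hus : vanishOn s u := vanishOn_image hA hs (vanishOn_bf hk)
  have hue : u (Sum.inr k) = 1 := by
    have := omg_mem.1 hA (bf k) (be k)
    rw [he, omg_be, omg_be] at this
    rw [hu, this]; simp [bf]
  set t := omg u (bf k) - 1 with ht
  set u' := u + t • be k with hu'
  have hek : (be k : (Fin n ⊕ Fin n) → R) (Sum.inr k) = 0 := by simp [be]
  have hfk : (bf k : (Fin n ⊕ Fin n) → R) (Sum.inr k) = 1 := by simp [bf]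
  have hu'k : u' (Sum.inr k) = 1 := by simp [hu', hue, hek]
  have hu's : vanishOn s u' := hus.add ((vanishOn_be hk).smul _)
  have hd : vanishOn s (bf k - u') := (vanishOn_bf hk).sub hu's
  have hdk : (bf k - u' : (Fin n ⊕ Fin n) → R) (Sum.inr k) = 0 := by simp [hfk, hu'k]
  apply hP (be k) t A (vanishOn_be hk) hek
  apply hP (bf k - u') 1 _ hd hdk
  have h1 : trv (be k) t *ᵥ u = u' := by
    rw [trv_apply, omg_be, hue, mul_one]
  have h2 : trv (bf k - u') 1 *ᵥ u' = bf k := by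
    have : omg u' (bf k - u') = 1 := by
      rw [omg_sub_right, omg_self, hu', omg_add_left, omg_smul_left, omg_bf (be k)]
      simp [be, ht]
    rw [trv_apply, this]; simp
  apply ih
  · exact mul_mem (trv_mem _ _) (mul_mem (trv_mem _ _) hA)
  · intro i hi
    rcases Finset.mem_insert.1 hi with rfl | hi
    · simp only [← Matrix.mulVec_mulVec]
      rw [he, ← hu, h1, h2]
      refine ⟨?_, rfl⟩
      rw [trv_fix (x := be i) (v := be i) (omg_self _)]
      apply trv_fix
      rw [omg_symm, omg_be, hdk, neg_zero]
    · exact fixOn_mul (fixOn_mul hs (vanishOn_be hk) t) hd 1 i hi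

/-- Moving `A e_k` to `e_k` by transvections. -/
lemma odd_step (sr : ∀ a b : R, IsCoprime a b → ∃ t, IsUnit (a + t * b))
    {s : Finset (Fin n)} {k : Fin n} (hk : k ∉ s)
    (P : Matrix (Fin n ⊕ Fin n) (Fin n ⊕ Fin n) R → Prop)
    (hP : ∀ v a A, vanishOn s v → P (trv v a * A) → P A)
    (ih : ∀ A ∈ Matrix.symplecticGroup (Fin n) R, fixOn s A → A *ᵥ be k = be k → P A)
    (A) (hA : A ∈ Matrix.symplecticGroup (Fin n) R) (hs : fixOn s A) : P A := by
  set e : (Fin n ⊕ Fin n) → R := be k with hedef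
  set f : (Fin n ⊕ Fin n) → R := bf k with hfdef
  have hfe : omg f e = 1 := by rw [hedef, omg_be]; simp [hfdef, bf]
  have hef : omg e f = -1 := by rw [omg_symm, hfe]
  set u := A *ᵥ e with hu
  set w := A *ᵥ f with hw
  have hes : vanishOn s e := vanishOn_be hk
  have hfs : vanishOn s f := vanishOn_bf hk
  have hus : vanishOn s u := vanishOn_image hA hs hes
  have hws : vanishOn s w := vanishOn_image hA hs hfs
  have huw : omg u w = -1 := by rw [hu, hw, omg_mem.1 hA, hef]
  -- decompose w
  set c := omg w e with hc
  set d := - omg w f with hd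
  set y := w - d • e - c • f with hy
  have hys : vanishOn s y := (hws.sub (hes.smul _)).sub (hfs.smul _)
  have hye : omg y e = 0 := by
    rw [hy, omg_sub_left, omg_sub_left, omg_smul_left, omg_smul_left, omg_self, hfe]; simp [hc]
  have hyf : omg y f = 0 := by
    rw [hy, omg_sub_left, omg_sub_left, omg_smul_left, omg_smul_left, omg_self, hef]; simp [hd]
  have hfy : omg f y = 0 := by rw [omg_symm, hyf, neg_zero]
  have hwy : w = y + d • e + c • f := by rw [hy]; abel
  have hcop : IsCoprime (omg u e) (c * omg u f + omg u y) := by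
    refine ⟨-d, -1, ?_⟩
    rw [hwy, omg_add_right, omg_add_right, omg_smul_right, omg_smul_right] at huw
    linear_combination -huw
  obtain ⟨t, ht⟩ := sr _ _ hcop
  set u1 := trv (t • y) (-1) *ᵥ u with hu1
  set u2 := trv (f + t • y) 1 *ᵥ u1 with hu2
  set u3 := trv f (t * c - 1) *ᵥ u2 with hu3
  have hu1s : vanishOn s u1 := by
    rw [hu1, trv_apply]; exact hus.add ((hys.smul _).smul _)
  have hu2s : vanishOn s u2 := by
    rw [hu2, trv_apply]; exact hu1s.add ((hfs.add (hys.smul _)).smul _)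
  have hu3s : vanishOn s u3 := by
    rw [hu3, trv_apply]; exact hu2s.add (hfs.smul _)
  have h3 : omg u3 e = omg u e + t * (c * omg u f + omg u y) := by
    simp only [hu3, hu2, hu1, trv_apply, omg_add_left, omg_add_right, omg_smul_left,
      omg_smul_right, omg_self, hfe, hye, hyf, hfy]
    ring
  rw [← h3] at ht
  obtain ⟨q, hq⟩ := ht
  have h4 : trv (e - u3) (↑q⁻¹) *ᵥ u3 = e := by
    rw [trv_apply, omg_sub_right, omg_self, ← hq]; simp
  apply hP (t • y) (-1) _ (hys.smul _)
  apply hP (f + t • y) 1 _ (hfs.add (hys.smul _))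
  apply hP f (t * c - 1) _ hfs
  apply hP (e - u3) (↑q⁻¹) _ (hes.sub hu3s)
  apply ih
  · exact mul_mem (trv_mem _ _) (mul_mem (trv_mem _ _) (mul_mem (trv_mem _ _)
      (mul_mem (trv_mem _ _) hA)))
  · exact fixOn_mul (fixOn_mul (fixOn_mul (fixOn_mul hs (hys.smul _) _)
      (hfs.add (hys.smul _)) _) hfs _) (hes.sub hu3s) _
  · simp only [← Matrix.mulVec_mulVec]
    rw [← hu, ← hu1, ← hu2, ← hu3, h4]

lemma fix_all {A : Matrix (Fin n ⊕ Fin n) (Fin n ⊕ Fin n) R} (h : fixOn Finset.univ A) :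
    A = 1 := by
  apply Matrix.ext_of_mulVec_single
  rintro (i | i)
  · rw [Matrix.one_mulVec]; exact (h i (Finset.mem_univ _)).1
  · rw [Matrix.one_mulVec]; exact (h i (Finset.mem_univ _)).2

lemma main_ind (sr : ∀ a b : R, IsCoprime a b → ∃ t, IsUnit (a + t * b)) (z : Fin n)
    (P : Matrix (Fin n ⊕ Fin n) (Fin n ⊕ Fin n) R → Prop)
    (h1 : P 1) (hP : ∀ v a A, v (Sum.inr z) = 0 → P (trv v a * A) → P A)
    (A) (hA : A ∈ Matrix.symplecticGroup (Fin n) R) (hz : A *ᵥ be z = be z) : P A := by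
  have main : ∀ (N : ℕ) (s : Finset (Fin n)), sᶜ.card = N → z ∈ s →
      ∀ A ∈ Matrix.symplecticGroup (Fin n) R, fixOn s A → P A := by
    intro N
    induction N with
    | zero =>
      intro s hs _ A _ hfix
      have : s = Finset.univ := by
        rw [Finset.card_eq_zero] at hs
        simpa using hs
      subst this
      rw [fix_all hfix]; exact h1
    | succ N IH =>
      intro s hs hzs A hA hfix
      obtain ⟨k, hk⟩ : (sᶜ).Nonempty := by rw [← Finset.card_pos]; omega
      have hk' : k ∉ s := by simpa using hk
      refine odd_step sr hk' P (fun v a A hv => hP v a A (hv z hzs).2) ?_ A hA hfix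
      intro A hA hfix he
      refine even_step hk' P (fun v a A hv _ => hP v a A (hv z hzs).2) ?_ A hA hfix he
      apply IH
      · rw [Finset.compl_insert, Finset.card_erase_of_mem hk, hs]; rfl
      · exact Finset.mem_insert_of_mem hzs
  refine even_step (s := ∅) (k := z) (by simp) P (fun v a A _ => hP v a A) ?_ A hA
    (by intro i hi; simp at hi) hz
  exact main _ _ rfl (by simp)

lemma zmod_sr (L : ℕ) (hL : 0 < L) (a b : ZMod L) (h : IsCoprime a b) :
    ∃ t, IsUnit (a + t * b) := by
  haveI : NeZero L := ⟨hL.ne'⟩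
  set t : ℕ := ∏ p ∈ L.primeFactors with ¬ p ∣ a.val, p with ht
  refine ⟨(t : ZMod L), ?_⟩
  have e : a + t * b = ((a.val + t * b.val : ℕ) : ZMod L) := by simp
  rw [e, ZMod.isUnit_iff_coprime]
  apply Nat.Coprime.symm
  apply Nat.coprime_of_dvd
  intro p hp hpL hdvd
  haveI := Fact.mk hp
  by_cases hpa : p ∣ a.val
  · have h2 : p ∣ t * b.val := (Nat.dvd_add_right hpa).1 hdvd
    rcases (hp.dvd_mul).1 h2 with h3 | h3
    · rw [ht, hp.prime.dvd_finset_prod_iff] at h3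
      obtain ⟨q, hq, hpq⟩ := h3
      rw [Finset.mem_filter] at hq
      have := (Nat.prime_dvd_prime_iff_eq hp (Nat.prime_of_mem_primeFactors hq.1)).1 hpq
      exact hq.2 (this ▸ hpa)
    · have hm := h.map (ZMod.castHom hpL (ZMod p))
      have ha0 : ZMod.castHom hpL (ZMod p) a = 0 := by
        rw [← ZMod.natCast_zmod_val a, map_natCast, ZMod.natCast_eq_zero_iff]; exact hpa
      have hb0 : ZMod.castHom hpL (ZMod p) b = 0 := by
        rw [← ZMod.natCast_zmod_val b, map_natCast, ZMod.natCast_eq_zero_iff]; exact h3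
      rw [ha0, hb0] at hm
      exact not_isCoprime_zero_zero hm
  · apply hpa
    refine (Nat.dvd_add_left (Dvd.dvd.mul_right ?_ _)).1 hdvd
    apply Finset.dvd_prod_of_mem (fun p => p)
    rw [Finset.mem_filter, Nat.mem_primeFactors]
    exact ⟨⟨hp, hpL, hL.ne'⟩, hpa⟩

lemma stdE1_succ (n : ℕ) : stdE1 (n + 1) = be 0 := by
  funext k
  rcases k with i | i
  · simp only [stdE1, be, Pi.single_apply, Sum.inl.injEq, Fin.ext_iff, Fin.val_zero]
  · simp [stdE1, be]

lemma map_trv {S : Type*} [CommRing S] (φ : R →+* S) (v : (Fin n ⊕ Fin n) → R) (a : R) :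
    φ.mapMatrix (trv v a) = trv (φ ∘ v) (φ a) := by
  have hJ : φ ∘ (Matrix.J (Fin n) R *ᵥ v) = Matrix.J (Fin n) S *ᵥ (φ ∘ v) := by
    have hm : (Matrix.J (Fin n) R).map φ = Matrix.J (Fin n) S := by
      ext i j
      rcases i with i | i <;> rcases j with j | j <;>
        simp [Matrix.J, Matrix.one_apply, apply_ite φ]
    funext i
    rw [← hm]
    exact RingHom.map_mulVec φ _ _ i
  ext i j
  simp only [trv, map_add, map_one, Matrix.add_apply, ← hJ]
  simp [Matrix.vecMulVec_apply]

end Helpers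

/-- Lifting from `ZMod L`. -/
lemma lift_stab (n L : ℕ) (hL : 0 < L)
    (A : Matrix (Fin (n+1) ⊕ Fin (n+1)) (Fin (n+1) ⊕ Fin (n+1)) (ZMod L))
    (hA : A ∈ Matrix.symplecticGroup (Fin (n+1)) (ZMod L)) (hz : A *ᵥ be 0 = be 0) :
    ∃ Y : spStabE1 (n+1), (Int.castRingHom (ZMod L)).mapMatrix
      (Y : Matrix.symplecticGroup (Fin (n+1)) ℤ).1 = A := by
  refine main_ind (zmod_sr L hL) 0 (fun A => ∃ Y : spStabE1 (n+1),
    (Int.castRingHom (ZMod L)).mapMatrix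
      (Y : Matrix.symplecticGroup (Fin (n+1)) ℤ).1 = A) ⟨1, ?_⟩ ?_ A hA hz
  · exact map_one _
  · rintro v a A hv ⟨Y, hY⟩
    set v' : (Fin (n+1) ⊕ Fin (n+1)) → ℤ := fun k => (v k).cast with hv'
    have hvv : (Int.castRingHom (ZMod L)) ∘ v' = v := by
      funext k; simp [hv']
    have hv0 : v' (Sum.inr 0) = 0 := by simp [hv', hv]
    let T : spStabE1 (n+1) := ⟨⟨trv v' (-(a.cast : ℤ)), trv_mem _ _⟩, by
      change trv v' (-(a.cast : ℤ)) *ᵥ stdE1 (n+1) = stdE1 (n+1)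
      rw [stdE1_succ]
      apply trv_fix
      rw [omg_symm, omg_be, hv0, neg_zero]⟩
    refine ⟨T * Y, ?_⟩
    change (Int.castRingHom (ZMod L)).mapMatrix (trv v' (-(a.cast : ℤ)) *
      (Y : Matrix.symplecticGroup (Fin (n+1)) ℤ).1) = A
    rw [map_mul, hY, map_trv, hvv, ← mul_assoc]
    have : (Int.castRingHom (ZMod L)) (-(a.cast : ℤ)) = -a := by simp
    rw [this, trv_inv, one_mul]

lemma spStabMod_eq_iff (g ℓ : ℕ) (A B : spStabE1 g) :
    spStabMod g ℓ A = spStabMod g ℓ B ↔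
      ∀ i j, (ℓ : ℤ) ∣ (A : Matrix.symplecticGroup (Fin g) ℤ).1 i j -
        (B : Matrix.symplecticGroup (Fin g) ℤ).1 i j := by
  rw [Units.ext_iff, ← Matrix.ext_iff]
  refine forall_congr' fun i => forall_congr' fun j => ?_
  change (((A : Matrix.symplecticGroup (Fin g) ℤ).1 i j : ℤ) : ZMod ℓ) =
    (((B : Matrix.symplecticGroup (Fin g) ℤ).1 i j : ℤ) : ZMod ℓ) ↔ _
  rw [← ZMod.intCast_zmod_eq_zero_iff_dvd, Int.cast_sub, sub_eq_zero]

lemma mem_spStabCong_iff (g ℓ : ℕ) (A : spStabE1 g) :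
    A ∈ spStabCong g ℓ ↔ ∀ i j, (ℓ : ℤ) ∣ (A : Matrix.symplecticGroup (Fin g) ℤ).1 i j -
        (1 : Matrix (Fin g ⊕ Fin g) (Fin g ⊕ Fin g) ℤ) i j := by
  rw [spStabCong, MonoidHom.mem_ker, ← map_one (spStabMod g ℓ), spStabMod_eq_iff]
  rfl

lemma crt_int (ℓ m : ℕ) (a b : ℤ) (h : ((Nat.gcd ℓ m : ℕ) : ℤ) ∣ a - b) :
    ∃ x : ℤ, (ℓ : ℤ) ∣ x - a ∧ (m : ℤ) ∣ x - b := by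
  obtain ⟨k, hk⟩ := h
  rw [Nat.gcd_eq_gcd_ab] at hk
  refine ⟨a - k * ℓ * Nat.gcdA ℓ m, ⟨-k * Nat.gcdA ℓ m, by ring⟩, ⟨k * Nat.gcdB ℓ m, ?_⟩⟩
  linear_combination hk

lemma intCast_lcm_eq_zero (ℓ m : ℕ) (x : ℤ) (h1 : (x : ZMod ℓ) = 0) (h2 : (x : ZMod m) = 0) :
    (x : ZMod (Nat.lcm ℓ m)) = 0 := by
  rw [ZMod.intCast_zmod_eq_zero_iff_dvd] at *
  rw [← Int.natAbs_dvd_natAbs, Int.natAbs_natCast] at *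
  exact Nat.lcm_dvd h1 h2

lemma map_J' {R S : Type*} [CommRing R] [CommRing S] (φ : R →+* S) (n : ℕ) :
    φ.mapMatrix (Matrix.J (Fin n) R) = Matrix.J (Fin n) S := by
  ext i j
  rcases i with i | i <;> rcases j with j | j <;>
    simp [Matrix.J, Matrix.one_apply, apply_ite φ]

lemma defect_zero (n ℓ : ℕ) (X Z : Matrix (Fin n ⊕ Fin n) (Fin n ⊕ Fin n) ℤ)
    (hZ : Z ∈ Matrix.symplecticGroup (Fin n) ℤ)
    (h : (Int.castRingHom (ZMod ℓ)).mapMatrix X = (Int.castRingHom (ZMod ℓ)).mapMatrix Z) :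
    (Int.castRingHom (ZMod ℓ)).mapMatrix (Xᵀ * Matrix.J (Fin n) ℤ * X - Matrix.J (Fin n) ℤ)
      = 0 := by
  have ht : (Int.castRingHom (ZMod ℓ)).mapMatrix Xᵀ = (Int.castRingHom (ZMod ℓ)).mapMatrix Zᵀ := by
    have := congrArg Matrix.transpose h
    simpa [RingHom.mapMatrix_apply, Matrix.transpose_map] using this
  rw [map_sub, map_mul, map_mul, h, ht, ← map_mul, ← map_mul, SymplecticGroup.mem_iff'.1 hZ,
    sub_self]

lemma exists_mix (g ℓ m : ℕ) (hℓ : 0 < ℓ) (hm : 0 < m) (A : spStabE1 g)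
    (hA : A ∈ spStabCong g (Nat.gcd ℓ m)) :
    ∃ C : spStabE1 g, spStabMod g ℓ C = spStabMod g ℓ A ∧ C ∈ spStabCong g m := by
  rw [mem_spStabCong_iff] at hA
  simp only [mem_spStabCong_iff, spStabMod_eq_iff]
  rcases g with _ | n
  · exact ⟨A, fun i => by rcases i with i | i <;> exact i.elim0,
      fun i => by rcases i with i | i <;> exact i.elim0⟩
  choose X hX1 hX2 using fun i j => crt_int ℓ m _ _ (hA i j)
  set L := Nat.lcm ℓ m with hL
  have hLpos : 0 < L := Nat.lcm_pos hℓ hm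
  set X' : Matrix (Fin (n+1) ⊕ Fin (n+1)) (Fin (n+1) ⊕ Fin (n+1)) ℤ := X with hX'
  set A' := (A : Matrix.symplecticGroup (Fin (n+1)) ℤ).1 with hA'
  have e1 : (Int.castRingHom (ZMod ℓ)).mapMatrix X' = (Int.castRingHom (ZMod ℓ)).mapMatrix A' := by
    ext i j
    have := (ZMod.intCast_zmod_eq_zero_iff_dvd _ _).2 (hX1 i j)
    rw [Int.cast_sub, sub_eq_zero] at this
    exact this
  have e2 : (Int.castRingHom (ZMod m)).mapMatrix X' = (Int.castRingHom (ZMod m)).mapMatrix 1 := by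
    ext i j
    have := (ZMod.intCast_zmod_eq_zero_iff_dvd _ _).2 (hX2 i j)
    rw [Int.cast_sub, sub_eq_zero] at this
    exact this
  have d1 := defect_zero _ ℓ X' A' (A : Matrix.symplecticGroup (Fin (n+1)) ℤ).2 e1
  have d2 := defect_zero _ m X' 1 (one_mem _) e2
  have d3 : (Int.castRingHom (ZMod L)).mapMatrix
      (X'ᵀ * Matrix.J (Fin (n+1)) ℤ * X' - Matrix.J (Fin (n+1)) ℤ) = 0 := by
    ext i j
    exact intCast_lcm_eq_zero ℓ m _ (congrFun (congrFun d1 i) j) (congrFun (congrFun d2 i) j)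
  have hsp : (Int.castRingHom (ZMod L)).mapMatrix X' ∈
      Matrix.symplecticGroup (Fin (n+1)) (ZMod L) := by
    rw [SymplecticGroup.mem_iff']
    rw [map_sub, sub_eq_zero, map_mul, map_mul, map_J'] at d3
    exact d3
  have hAe : A' *ᵥ be 0 = be 0 := by
    have := A.2
    change A' *ᵥ stdE1 (n+1) = stdE1 (n+1) at this
    rwa [stdE1_succ] at this
  have hfix : (Int.castRingHom (ZMod L)).mapMatrix X' *ᵥ be 0 = be 0 := by
    funext i
    have hAi : A' i (Sum.inl 0) = (be 0 : (Fin (n+1) ⊕ Fin (n+1)) → ℤ) i := by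
      rw [← congrFun hAe i]; simp [be]
    have h1i : (1 : Matrix (Fin (n+1) ⊕ Fin (n+1)) (Fin (n+1) ⊕ Fin (n+1)) ℤ) i (Sum.inl 0)
        = (be 0 : (Fin (n+1) ⊕ Fin (n+1)) → ℤ) i := by
      by_cases h : i = Sum.inl 0
      · subst h; simp [be]
      · rw [Matrix.one_apply_ne h, be, Pi.single_eq_of_ne h]
    have k1 := (ZMod.intCast_zmod_eq_zero_iff_dvd _ _).2 (hX1 i (Sum.inl 0))
    have k2 := (ZMod.intCast_zmod_eq_zero_iff_dvd _ _).2 (hX2 i (Sum.inl 0))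
    rw [hAi] at k1
    rw [h1i] at k2
    have k3 := intCast_lcm_eq_zero ℓ m _ k1 k2
    rw [Int.cast_sub, sub_eq_zero] at k3
    have k4 : (((be 0 : (Fin (n+1) ⊕ Fin (n+1)) → ℤ) i : ℤ) : ZMod L) = be 0 i := by
      simp only [be, Pi.single_apply]; split_ifs <;> simp
    rw [← k4, ← k3]
    simp only [be, Matrix.mulVec_single_one]
    rfl
  obtain ⟨Y, hY⟩ := lift_stab n L hLpos _ hsp hfix
  have hYX : ∀ i j, (L : ℤ) ∣ (Y : Matrix.symplecticGroup (Fin (n+1)) ℤ).1 i j - X' i j := by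
    intro i j
    have := congrFun (congrFun hY i) j
    rw [← ZMod.intCast_zmod_eq_zero_iff_dvd, Int.cast_sub, sub_eq_zero]
    exact this
  refine ⟨Y, fun i j => ?_, fun i j => ?_⟩
  · have := dvd_add ((Int.natCast_dvd_natCast.2 (Nat.dvd_lcm_left ℓ m)).trans (hYX i j)) (hX1 i j)
    simpa using this
  · have := dvd_add ((Int.natCast_dvd_natCast.2 (Nat.dvd_lcm_right ℓ m)).trans (hYX i j)) (hX2 i j)
    simpa using this

open Pointwise in
theorem spStabCong_inf_and_mul (g : ℕ) (ℓ m : ℕ) (hℓ : 0 < ℓ) (hm : 0 < m) :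
    spStabCong g ℓ ⊓ spStabCong g m = spStabCong g (Nat.lcm ℓ m) ∧
    (spStabCong g ℓ : Set (spStabE1 g)) * (spStabCong g m : Set (spStabE1 g)) =
      (spStabCong g (Nat.gcd ℓ m) : Set (spStabE1 g)) := by
  have mono : ∀ a b : ℕ, a ∣ b → spStabCong g b ≤ spStabCong g a := by
    intro a b hab A hA
    rw [mem_spStabCong_iff] at *
    exact fun i j => (Int.natCast_dvd_natCast.2 hab).trans (hA i j)
  constructor
  · apply le_antisymm
    · rintro A ⟨h1, h2⟩
      have h1 := (mem_spStabCong_iff _ _ _).1 h1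
      have h2 := (mem_spStabCong_iff _ _ _).1 h2
      rw [mem_spStabCong_iff]
      intro i j
      have h1 := h1 i j
      have h2 := h2 i j
      rw [← ZMod.intCast_zmod_eq_zero_iff_dvd] at *
      exact intCast_lcm_eq_zero _ _ _ h1 h2
    · exact le_inf (mono _ _ (Nat.dvd_lcm_left _ _)) (mono _ _ (Nat.dvd_lcm_right _ _))
  · apply Set.Subset.antisymm
    · rintro _ ⟨B, hB, C, hC, rfl⟩
      exact mul_mem (mono _ _ (Nat.gcd_dvd_left _ _) hB) (mono _ _ (Nat.gcd_dvd_right _ _) hC)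
    · intro A hA
      obtain ⟨C, h1, h2⟩ := exists_mix g ℓ m hℓ hm A hA
      refine ⟨A * C⁻¹, ?_, C, h2, by simp⟩
      change A * C⁻¹ ∈ (spStabMod g ℓ).ker
      rw [MonoidHom.mem_ker, map_mul, map_inv, h1, mul_inv_cancel]
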